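/- Let K/F be a cyclic Galois field extension of degree n, let σ be a generator of Gal(K/F), let m ≥ 2 with n ≥ m−1, and let a, b ∈ K ∖ F. If there is no k ∈ K^× with N_{K/F}(a) = N_{K/F}(k)^m · N_{K/F}(b) (i.e. N_{K/F}(a) ∉ (N_{K/F}(K^×))^m · N_{K/F}(b)), then the Petit algebras S_{t^m−a} and S_{t^m−b} (both formed in K[t;σ]) are not isomorphic as F-algebras. -/

import Mathlib

/-- The multiplication of the Petit algebra `S_{t^m - a} = K[t;σ]/K[t;σ](t^m - a)`,
on the `F`-vector space `Fin m → K` (coordinates with respect to the `K`-basis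
`t^0, …, t^{m-1}`). -/
noncomputable def petitMul {F K : Type*} [Field F] [Field K] [Algebra F K]
    (σ : K ≃ₐ[F] K) (a : K) (m : ℕ) (x y : Fin m → K) : Fin m → K :=
  fun l =>
    (∑ i : Fin m, ∑ j : Fin m,
      if (i : ℕ) + (j : ℕ) = (l : ℕ) then x i * (σ ^ (i : ℕ)) (y j) else 0)
    + (∑ i : Fin m, ∑ j : Fin m,
      if (i : ℕ) + (j : ℕ) = (l : ℕ) + m then
        x i * (σ ^ (i : ℕ)) (y j) * (σ ^ (l : ℕ)) a else 0)

/-- Isomorphism of Petit algebras as `F`-algebras: an `F`-linear bijection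
preserving multiplication. -/
def PetitIso {F K : Type*} [Field F] [Field K] [Algebra F K]
    (σ₁ σ₂ : K ≃ₐ[F] K) (a₁ a₂ : K) (m : ℕ) : Prop :=
  ∃ e : (Fin m → K) ≃ₗ[F] (Fin m → K),
    ∀ x y : Fin m → K, e (petitMul σ₁ a₁ m x y) = petitMul σ₂ a₂ m (e x) (e y)

section PetitAlgebra

variable {F K : Type*} [Field F] [Field K] [Algebra F K] (σ : K ≃ₐ[F] K) (a : K) {m : ℕ}

/-- Right multiplication by the monomial `c t^j`. -/
lemma petitMul_single_right (x : Fin m → K) (j : Fin m) (c : K) (l : Fin m) :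
    petitMul σ a m x (Pi.single j c) l =
      if h : (j : ℕ) ≤ l then
        x ⟨l - j, by omega⟩ * (σ ^ ((l : ℕ) - j)) c
      else x ⟨l + m - j, by omega⟩ * (σ ^ ((l : ℕ) + m - j)) c * (σ ^ (l : ℕ)) a := by
  have inner (f : Fin m → K → K) (p : Fin m → ℕ → Prop) [∀ i k, Decidable (p i k)]
      (hf : ∀ i, f i 0 = 0) (i : Fin m) :
      (∑ k : Fin m, if p i k then f i ((Pi.single j c : Fin m → K) k) else 0) =
        if p i j then f i c else 0 := by
    rw [Finset.sum_eq_single j]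
    · simp
    · intro k _ hk
      simp [Pi.single_eq_of_ne hk, hf]
    · simp
  unfold petitMul
  rw [Finset.sum_congr rfl fun i _ => inner (fun i y => x i * (σ ^ (i : ℕ)) y)
      (fun i k => (i : ℕ) + k = l) (by simp) i,
    Finset.sum_congr rfl fun i _ => inner (fun i y => x i * (σ ^ (i : ℕ)) y * (σ ^ (l : ℕ)) a)
      (fun i k => (i : ℕ) + k = l + m) (by simp) i]
  split_ifs with h
  · rw [Finset.sum_eq_single ⟨l - j, by omega⟩, Finset.sum_eq_zero, add_zero, if_pos]
    · simp only
      omega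
    · intro i _
      rw [if_neg]
      omega
    · intro i _ hi
      rw [if_neg]
      simp only [ne_eq, Fin.ext_iff] at hi
      omega
    · simp
  · rw [Finset.sum_eq_zero, zero_add, Finset.sum_eq_single ⟨l + m - j, by omega⟩, if_pos]
    · simp only
      omega
    · intro i _ hi
      rw [if_neg]
      simp only [ne_eq, Fin.ext_iff] at hi
      omega
    · simp
    · intro i _
      rw [if_neg]
      omega

lemma petitMul_single_single_of_lt (i j : Fin m) (h : (i : ℕ) + j < m) (x y : K) :
    petitMul σ a m (Pi.single i x) (Pi.single j y) =
      Pi.single ⟨i + j, h⟩ (x * (σ ^ (i : ℕ)) y) := by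
  ext l
  rw [petitMul_single_right]
  simp only [Pi.single_apply, Fin.ext_iff]
  split_ifs <;> first | omega | simp_all

lemma petitMul_single_single_of_add_eq (i j : Fin m) (h : (i : ℕ) + j = m) (x y : K) :
    petitMul σ a m (Pi.single i x) (Pi.single j y) =
      Pi.single ⟨0, i.pos⟩ (x * (σ ^ (i : ℕ)) y * a) := by
  ext l
  rw [petitMul_single_right]
  simp only [Pi.single_apply, Fin.ext_iff]
  split_ifs with _ _ _ _ _ h₆ <;> first | omega | simp
  have hi : m - (j : ℕ) = i := by omega
  simp [hi, h₆]

lemma petitMul_smul (c : K) (x y : Fin m → K) :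
    petitMul σ a m (c • x) y = c • petitMul σ a m x y := by
  ext l
  simp [petitMul, mul_add, Finset.mul_sum, mul_assoc]

lemma petitMul_single_zero_left (hm : 0 < m) (c : K) (y : Fin m → K) :
    petitMul σ a m (Pi.single ⟨0, hm⟩ c) y = c • y := by
  ext l
  simp only [petitMul]
  rw [Finset.sum_eq_single ⟨0, hm⟩, Finset.sum_eq_single l, Finset.sum_eq_zero]
  · simp
  · intro i _
    refine Finset.sum_eq_zero fun j _ => ?_
    by_cases hi : i = ⟨0, hm⟩
    · subst hi
      rw [if_neg]
      simp only
      omega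
    · simp [Pi.single_eq_of_ne hi]
  · intro j _ hj
    rw [if_neg]
    simp only [ne_eq, Fin.ext_iff] at hj
    simp only
    omega
  · simp
  · intro i _ hi
    simp [Pi.single_eq_of_ne hi]
  · simp

/-- If `σ a ≠ a`, the left nucleus of `S_{t^m - a}` is contained in `K`. -/
lemma eq_single_zero_of_petitMul_assoc (hm : 2 ≤ m) (ha : σ a ≠ a) (x : Fin m → K)
    (hx : ∀ y z, petitMul σ a m (petitMul σ a m x y) z =
      petitMul σ a m x (petitMul σ a m y z)) :
    x = Pi.single ⟨0, by omega⟩ (x ⟨0, by omega⟩) := by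
  ext d
  by_cases hd : d = ⟨0, by omega⟩
  · subst hd
    simp
  rw [Pi.single_eq_of_ne hd]
  simp only [Fin.ext_iff] at hd
  have key := congrFun (hx (Pi.single ⟨m - d, by omega⟩ 1) (Pi.single ⟨1, by omega⟩ 1))
    ⟨1, by omega⟩
  have hl : petitMul σ a m (petitMul σ a m x (Pi.single ⟨m - d, by omega⟩ 1))
      (Pi.single ⟨1, by omega⟩ 1) ⟨1, by omega⟩ = x d * a := by
    have hmd : m - (m - (d : ℕ)) = d := by omega
    have hdm : ¬ m ≤ (d : ℕ) := by omega
    simp [petitMul_single_right, Nat.sub_eq_zero_iff_le, hmd, hdm]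
  have hr : petitMul σ a m x (petitMul σ a m (Pi.single ⟨m - d, by omega⟩ 1)
      (Pi.single ⟨1, by omega⟩ 1)) ⟨1, by omega⟩ = x d * σ a := by
    by_cases h1 : (d : ℕ) = 1
    · rw [petitMul_single_single_of_add_eq _ _ _ _ (by simp only; omega), petitMul_single_right]
      have hd1 : d = ⟨1, by omega⟩ := Fin.ext h1
      simp [← hd1]
    · rw [petitMul_single_single_of_lt _ _ _ _ (by simp only; omega), petitMul_single_right,
        dif_neg (by simp only; omega)]
      have hmd : 1 + m - (m - (d : ℕ) + 1) = d := by omega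
      simp [hmd]
  rw [hl, hr] at key
  by_contra h0
  exact ha (mul_left_cancel₀ h0 key).symm

/-- An isomorphism onto `S_{t^m - b}` with `σ b ≠ b` restricts to an automorphism of `K`. -/
lemma exists_algEquiv_of_petitMul_map [FiniteDimensional F K] (b : K) (hm : 2 ≤ m)
    (hb : σ b ≠ b) (e : (Fin m → K) ≃ₗ[F] (Fin m → K))
    (he : ∀ x y, e (petitMul σ a m x y) = petitMul σ b m (e x) (e y)) :
    ∃ τ : K ≃ₐ[F] K, ∀ c, e (Pi.single ⟨0, by omega⟩ c) = Pi.single ⟨0, by omega⟩ (τ c) := by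
  have h0 : 0 < m := by omega
  have hnuc (c : K) : e (Pi.single ⟨0, h0⟩ c) =
      Pi.single ⟨0, h0⟩ (e (Pi.single ⟨0, h0⟩ c) ⟨0, h0⟩) := by
    refine eq_single_zero_of_petitMul_assoc σ b hm hb _ fun y z => ?_
    obtain ⟨y, rfl⟩ := e.surjective y
    obtain ⟨z, rfl⟩ := e.surjective z
    simp only [← he, petitMul_single_zero_left, petitMul_smul]
  let f : K →ₗ[F] K :=
    LinearMap.proj ⟨0, h0⟩ ∘ₗ e.toLinearMap ∘ₗ LinearMap.single F (fun _ => K) ⟨0, h0⟩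
  have hf (c : K) : e (Pi.single ⟨0, h0⟩ c) = Pi.single ⟨0, h0⟩ (f c) := hnuc c
  have hmul (c d : K) : f (c * d) = f c * f d := by
    have h := he (Pi.single ⟨0, h0⟩ c) (Pi.single ⟨0, h0⟩ d)
    rw [petitMul_single_zero_left, ← Pi.single_smul, hf, hf, hf, petitMul_single_zero_left,
      ← Pi.single_smul] at h
    simpa using Pi.single_injective _ h
  have hinj : Function.Injective f := by
    intro c d hcd
    apply Pi.single_injective (M := fun _ : Fin m => K) ⟨0, h0⟩
    apply e.injective
    rw [hf, hf, hcd]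
  have hone : f 1 = 1 := by
    have h1 : f 1 ≠ 0 := fun h => one_ne_zero (hinj (h.trans f.map_zero.symm))
    refine mul_left_cancel₀ h1 ?_
    rw [← hmul, mul_one, mul_one]
  let g : K →ₐ[F] K := AlgHom.ofLinearMap f hone hmul
  exact ⟨AlgEquiv.ofBijective g ⟨hinj, LinearMap.surjective_of_injective hinj⟩, hf⟩

/-- A map compatible with the automorphism `τ` of `K` sends `t` to a multiple of `t`. -/
lemma petitMul_map_t_eq_single (b : K) (hm : 2 ≤ m)
    (hinj : ∀ l < m, σ ^ l = σ → l = 1) (e : (Fin m → K) ≃ₗ[F] (Fin m → K))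
    (he : ∀ x y, e (petitMul σ a m x y) = petitMul σ b m (e x) (e y))
    (τ : K ≃ₐ[F] K) (hτ : ∀ c, e (Pi.single ⟨0, by omega⟩ c) = Pi.single ⟨0, by omega⟩ (τ c))
    (hcomm : ∀ c, τ (σ c) = σ (τ c)) :
    ∃ k : K, e (Pi.single ⟨1, by omega⟩ 1) = Pi.single ⟨1, by omega⟩ k := by
  set g := e (Pi.single ⟨1, by omega⟩ 1) with hg
  refine ⟨g ⟨1, by omega⟩, ?_⟩
  ext l
  by_cases hl : l = ⟨1, by omega⟩
  · subst hl
    simp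
  rw [Pi.single_eq_of_ne hl]
  by_contra hne
  refine hl (Fin.ext (hinj l l.2 (AlgEquiv.ext fun w => ?_)))
  obtain ⟨z, rfl⟩ := τ.surjective w
  have h₁ := he (Pi.single ⟨1, by omega⟩ 1) (Pi.single ⟨0, by omega⟩ z)
  have h₂ := he (Pi.single ⟨0, by omega⟩ (σ z)) (Pi.single ⟨1, by omega⟩ 1)
  rw [petitMul_single_single_of_lt _ _ _ _ (by simp only; omega)] at h₁ h₂
  rw [hτ, ← hg] at h₁ h₂
  simp only [zero_add, add_zero, pow_one, pow_zero, one_mul, map_one, mul_one] at h₁ h₂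
  have h := congrFun (h₁.symm.trans h₂) l
  rw [petitMul_single_right, petitMul_single_zero_left, dif_pos (Nat.zero_le _)] at h
  simp only [tsub_zero, Fin.eta, Pi.smul_apply, smul_eq_mul, hcomm] at h
  rw [mul_comm] at h
  exact mul_right_cancel₀ hne h

/-- The image of `t^i` when `t ↦ k t`. -/
lemma petitMul_map_t_pow (b : K) (hm : 2 ≤ m) (e : (Fin m → K) ≃ₗ[F] (Fin m → K))
    (he : ∀ x y, e (petitMul σ a m x y) = petitMul σ b m (e x) (e y))
    (hone : e (Pi.single ⟨0, by omega⟩ 1) = Pi.single ⟨0, by omega⟩ 1) (k : K)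
    (hk : e (Pi.single ⟨1, by omega⟩ 1) = Pi.single ⟨1, by omega⟩ k) (i : ℕ) (hi : i < m) :
    ∃ c : K, e (Pi.single ⟨i, hi⟩ 1) = Pi.single ⟨i, hi⟩ c ∧
      Algebra.norm F c = Algebra.norm F k ^ i := by
  induction i with
  | zero => exact ⟨1, hone, by simp⟩
  | succ i ih =>
    obtain ⟨c, hc, hN⟩ := ih (by omega)
    refine ⟨c * (σ ^ i) k, ?_, ?_⟩
    · have h := he (Pi.single ⟨i, by omega⟩ 1) (Pi.single ⟨1, by omega⟩ 1)
      rw [hc, hk, petitMul_single_single_of_lt _ _ _ _ hi,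
        petitMul_single_single_of_lt _ _ _ _ hi] at h
      simpa using h
    · rw [map_mul, hN, Algebra.norm_eq_of_algEquiv, pow_succ]

end PetitAlgebra

/-- Let `K/F` be cyclic Galois of degree `n`, `σ` a generator,
`m ≥ 2` with `n ≥ m-1`, and `a, b ∈ K ∖ F`. If there is no `k ∈ K^×` with
`N_{K/F}(a) = N_{K/F}(k)^m · N_{K/F}(b)`, then `S_{t^m-a}` and `S_{t^m-b}`
(both formed in `K[t;σ]`) are not isomorphic as `F`-algebras. -/
theorem stmt_11 {F K : Type*} [Field F] [Field K] [Algebra F K]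
    [IsGalois F K] [FiniteDimensional F K]
    (n m : ℕ) (hdeg : Module.finrank F K = n) (hm : 2 ≤ m) (hnm : m - 1 ≤ n)
    (σ : K ≃ₐ[F] K)
    (hgen : ∀ τ : K ≃ₐ[F] K, τ ∈ Subgroup.zpowers σ)
    (a b : K)
    (ha : a ∉ Set.range (algebraMap F K))
    (hb : b ∉ Set.range (algebraMap F K))
    (hnorm : ¬ ∃ k : K, k ≠ 0 ∧
      Algebra.norm F a = (Algebra.norm F k) ^ m * Algebra.norm F b) :
    ¬ PetitIso σ σ a b m := by
  rintro ⟨e, he⟩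
  have hb' : σ b ≠ b := by
    intro h
    refine hb ((IsGalois.mem_range_algebraMap_iff_fixed b).2 fun τ => ?_)
    have hσ : σ ∈ MulAction.stabilizer (K ≃ₐ[F] K) b := h
    exact (Subgroup.zpowers_le.2 hσ) (hgen τ)
  have hord : orderOf σ = n := by
    rw [orderOf_eq_card_of_forall_mem_zpowers hgen, IsGalois.card_aut_eq_finrank, hdeg]
  have hn : 2 ≤ n := by
    have h0 : 0 < orderOf σ := orderOf_pos σ
    have h1 : orderOf σ ≠ 1 := fun h => hb' (by rw [orderOf_eq_one_iff.1 h]; rfl)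
    omega
  have hinj : ∀ l < m, σ ^ l = σ → l = 1 := by
    intro l hl h
    have h' : l ≡ 1 [MOD n] := by
      rw [← hord, ← pow_eq_pow_iff_modEq, h, pow_one]
    rcases (show l ≤ n by omega).eq_or_lt with rfl | hln
    · simp [Nat.ModEq, Nat.mod_eq_of_lt (show 1 < l by omega)] at h'
    · exact h'.eq_of_lt_of_lt hln (by omega)
  obtain ⟨τ, hτ⟩ := exists_algEquiv_of_petitMul_map σ a b hm hb' e he
  have hcomm (c : K) : τ (σ c) = σ (τ c) := by
    obtain ⟨z, rfl⟩ := Subgroup.mem_zpowers_iff.1 (hgen τ)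
    exact DFunLike.congr_fun ((Commute.refl σ).zpow_left z).eq c
  obtain ⟨k, hk⟩ := petitMul_map_t_eq_single σ a b hm hinj e he τ hτ hcomm
  obtain ⟨c, hc, hN⟩ := petitMul_map_t_pow σ a b hm e he (by rw [hτ, map_one]) k hk
    (m - 1) (by omega)
  refine hnorm ⟨k, ?_, ?_⟩
  · rintro rfl
    rw [Pi.single_zero, LinearEquiv.map_eq_zero_iff, Pi.single_eq_zero_iff] at hk
    exact one_ne_zero hk
  · have h := he (Pi.single ⟨m - 1, by omega⟩ 1) (Pi.single ⟨1, by omega⟩ 1)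
    rw [hc, hk, petitMul_single_single_of_add_eq _ _ _ _ (by simp only; omega),
      petitMul_single_single_of_add_eq _ _ _ _ (by simp only; omega), hτ] at h
    have h' := congrArg (Algebra.norm F) (Pi.single_injective _ h)
    simp only [map_one, one_mul, map_mul, Algebra.norm_eq_of_algEquiv, hN] at h'
    rw [h', ← pow_succ, Nat.sub_add_cancel (by omega)]
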